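/- Let (Ω, ℱ) be a measurable space, Θ ⊆ ℝ, and {P_θ : θ ∈ Θ} a family of probability measures on Ω with P_{θ′} absolutely continuous with respect to P_θ and D(P_{θ′}‖P_θ) < ∞ for all θ, θ′ ∈ Θ. Let θ̂ : Ω → ℝ be a measurable estimator that is unbiased at every θ′ ∈ Θ (∫ θ̂ dP_{θ′} = θ′) with ∫ (θ̂ − θ′)² dP_{θ′} < ∞ for all θ′, and let B : Θ → ℝ satisfy ∫ (θ̂ − θ′)² dP_{θ′} ≥ B(θ′) for every θ′ ∈ Θ. Then for every α > 0 and θ ∈ Θ: ln ∫ exp( α·(θ̂ − θ)² ) dP_θ ≥ sup_{θ′∈Θ} [ α·B(θ′) + α·(θ − θ′)² − D(P_{θ′}‖P_θ) ]. -/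

import Mathlib

open MeasureTheory

lemma ofReal_exp_integral_le_lintegral {Ω : Type*} [MeasurableSpace Ω] {μ : Measure Ω}
    [IsProbabilityMeasure μ] {f : Ω → ℝ} (hf : Integrable f μ) :
    ENNReal.ofReal (Real.exp (∫ x, f x ∂μ)) ≤ ∫⁻ x, ENNReal.ofReal (Real.exp (f x)) ∂μ := by
  have hm : AEStronglyMeasurable (fun x => Real.exp (f x)) μ :=
    Real.continuous_exp.comp_aestronglyMeasurable hf.1
  have hnn : 0 ≤ᵐ[μ] fun x => Real.exp (f x) := ae_of_all _ fun x => (Real.exp_pos _).le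
  by_cases htop : ∫⁻ x, ENNReal.ofReal (Real.exp (f x)) ∂μ = ⊤
  · simp [htop]
  have hi : Integrable (fun x => Real.exp (f x)) μ :=
    (lintegral_ofReal_ne_top_iff_integrable hm hnn).1 htop
  rw [← ofReal_integral_eq_lintegral_ofReal hi hnn]
  exact ENNReal.ofReal_le_ofReal <| convexOn_exp.map_integral_le
    Real.continuous_exp.continuousOn isClosed_univ (ae_of_all _ fun _ => Set.mem_univ _) hf hi

/-- A version of `lintegral_rnDeriv_mul` assuming measurability only with respect to `μ`. -/
lemma lintegral_rnDeriv_mul_of_aemeasurable_left {Ω : Type*} [MeasurableSpace Ω]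
    {μ ν : Measure Ω} [μ.HaveLebesgueDecomposition ν] (hμν : μ ≪ ν) {f : Ω → ENNReal}
    (hf : AEMeasurable f μ) : ∫⁻ x, μ.rnDeriv ν x * f x ∂ν = ∫⁻ x, f x ∂μ := by
  rw [← Measure.withDensity_rnDeriv_eq μ ν hμν] at hf
  conv_rhs => rw [← Measure.withDensity_rnDeriv_eq μ ν hμν]
  exact (lintegral_withDensity_eq_lintegral_mul₀' (μ.measurable_rnDeriv ν).aemeasurable hf).symm

/-- One direction of the Donsker–Varadhan variational formula. -/
lemma ofReal_exp_integral_sub_integral_llr_le_lintegral {Ω : Type*} [MeasurableSpace Ω]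
    {μ ν : Measure Ω} [IsProbabilityMeasure μ] [SigmaFinite ν] (hμν : μ ≪ ν)
    (hllr : Integrable (llr μ ν) μ) {f : Ω → ℝ} (hf : Integrable f μ) :
    ENNReal.ofReal (Real.exp (∫ x, f x ∂μ - ∫ x, llr μ ν x ∂μ)) ≤
      ∫⁻ x, ENNReal.ofReal (Real.exp (f x)) ∂ν := by
  rw [← integral_sub hf hllr]
  refine (ofReal_exp_integral_le_lintegral (hf.sub hllr)).trans ?_
  have hm : AEMeasurable (fun x => ENNReal.ofReal (Real.exp (f x - llr μ ν x))) μ :=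
    (Real.measurable_exp.comp_aemeasurable (hf.sub hllr).1.aemeasurable).ennreal_ofReal
  calc ∫⁻ x, ENNReal.ofReal (Real.exp (f x - llr μ ν x)) ∂μ
      = ∫⁻ x, μ.rnDeriv ν x * ENNReal.ofReal (Real.exp (f x - llr μ ν x)) ∂ν := by
        rw [lintegral_rnDeriv_mul_of_aemeasurable_left hμν hm]
    _ ≤ ∫⁻ x, ENNReal.ofReal (Real.exp (f x)) ∂ν := by
        refine lintegral_mono_ae ?_
        filter_upwards [μ.rnDeriv_lt_top ν] with x hx
        rcases eq_or_ne (μ.rnDeriv ν x) 0 with h0 | h0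
        · simp [h0]
        have hpos : 0 < (μ.rnDeriv ν x).toReal := ENNReal.toReal_pos h0 hx.ne
        rw [← ENNReal.ofReal_toReal hx.ne, ← ENNReal.ofReal_mul hpos.le, llr, Real.exp_sub,
          Real.exp_log hpos, mul_div_cancel₀ _ hpos.ne']

/-- Section 6 of the paper: if `B(θ′)` lower-bounds the variance of an unbiased
estimator at every `θ′ ∈ Θ` (e.g. the Cramér–Rao bound), then for every `α > 0`
and `θ ∈ Θ`,
`ln ∫ exp(α (θ̂ − θ)²) dP_θ ≥ sup_{θ′ ∈ Θ} [α B(θ′) + α (θ − θ′)² − D(P_{θ′}‖P_θ)]`.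
This is stated in the equivalent pointwise form: for every `θ′ ∈ Θ`,
`∫ exp(α (θ̂ − θ)²) dP_θ ≥ exp(α B(θ′) + α (θ − θ′)² − D(P_{θ′}‖P_θ))`,
with `D(P_{θ′}‖P_θ) = ∫ llr(P_{θ′}, P_θ) dP_{θ′}` and the left-hand side a lower
integral (possibly infinite). -/
theorem exp_moment_lower_bound_from_variance_bound
    (Ω : Type) [MeasurableSpace Ω] (Θ : Set ℝ)
    (P : ℝ → Measure Ω) (hprob : ∀ ϑ ∈ Θ, IsProbabilityMeasure (P ϑ))
    (hac : ∀ ϑ ∈ Θ, ∀ ϑ' ∈ Θ, P ϑ' ≪ P ϑ)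
    (hD : ∀ ϑ ∈ Θ, ∀ ϑ' ∈ Θ, Integrable (llr (P ϑ') (P ϑ)) (P ϑ'))
    (est : Ω → ℝ) (hest : Measurable est)
    (hest_int : ∀ ϑ' ∈ Θ, Integrable est (P ϑ'))
    (hunbiased : ∀ ϑ' ∈ Θ, ∫ x, est x ∂(P ϑ') = ϑ')
    (hmoment : ∀ ϑ' ∈ Θ, Integrable (fun x => (est x - ϑ') ^ 2) (P ϑ'))
    (B : ℝ → ℝ)
    (hB : ∀ ϑ' ∈ Θ, B ϑ' ≤ ∫ x, (est x - ϑ') ^ 2 ∂(P ϑ'))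
    (α : ℝ) (hα : 0 < α) (θ : ℝ) (hθ : θ ∈ Θ) :
    ∀ θ' ∈ Θ,
      ∫⁻ x, ENNReal.ofReal (Real.exp (α * (est x - θ) ^ 2)) ∂(P θ) ≥
        ENNReal.ofReal (Real.exp
          (α * B θ' + α * (θ - θ') ^ 2 - ∫ x, llr (P θ') (P θ) x ∂(P θ'))) := by
  intro θ' hθ'
  have := hprob θ hθ
  have := hprob θ' hθ'
  have hdev : Integrable (fun x => est x - θ') (P θ') :=
    (hest_int θ' hθ').sub (integrable_const _)
  have hlin : Integrable (fun x => 2 * (θ' - θ) * (est x - θ') + (θ - θ') ^ 2) (P θ') :=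
    (hdev.const_mul _).add (integrable_const _)
  have hsq : (fun x => α * (est x - θ) ^ 2) = fun x =>
      α * ((est x - θ') ^ 2 + (2 * (θ' - θ) * (est x - θ') + (θ - θ') ^ 2)) := by
    funext x; ring
  have hf : Integrable (fun x => α * (est x - θ) ^ 2) (P θ') := by
    rw [hsq]
    exact ((hmoment θ' hθ').add hlin).const_mul α
  have hmean : ∫ x, (est x - θ') ∂(P θ') = 0 := by
    rw [integral_sub (hest_int θ' hθ') (integrable_const _), hunbiased θ' hθ']
    simp
  have hval : ∫ x, α * (est x - θ) ^ 2 ∂(P θ') =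
      α * (∫ x, (est x - θ') ^ 2 ∂(P θ') + (θ - θ') ^ 2) := by
    rw [hsq, integral_const_mul, integral_add (hmoment θ' hθ') hlin,
      integral_add (hdev.const_mul _) (integrable_const _), integral_const_mul, hmean]
    simp
  refine le_trans (ENNReal.ofReal_le_ofReal (Real.exp_le_exp.2 ?_))
    (ofReal_exp_integral_sub_integral_llr_le_lintegral (hac θ hθ θ' hθ') (hD θ hθ θ' hθ') hf)
  rw [hval, mul_add]
  gcongr
  exact hB θ' hθ'
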